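/- arXiv:1306.0654 — 6 statements merged into one kernel-verified Lean document; each statement's English description precedes it below -/
import Mathlib

section
/- (Theorem 2.1, positivity of the forward-Euler finite-difference scheme for a monotone increasing flux in cylindrical coordinates.) Let r_i > 0, λ > 0, α > 0 and ω_N ∈ (0,1) be real numbers, let f : ℝ → ℝ be differentiable with f(0) = 0 and 0 ≤ f'(x) ≤ α for all x ∈ ℝ, and let u_i > 0 be a real number. Suppose the real numbers h_star, h_plus, h_minus satisfy the Gauss–Lobatto decomposition r_i·f(u_i) = (1 − ω_N)·h_star + ω_N·h_plus. Define u_new by r_i·u_new = r_i·u_i − λ·(h_plus − h_minus). If h_star ≥ 0, h_plus ≥ 0, h_minus ≥ 0 and α·λ ≤ ω_N, then u_new ≥ 0; if moreover the strict CFL condition α·λ < ω_N holds, then u_new > 0. -/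
/-- Theorem 2.1: positivity of the forward-Euler finite-difference scheme for a
monotone increasing flux in cylindrical coordinates. -/
theorem stmt_0
    (r lam alpha omegaN : ℝ) (hr : 0 < r) (hlam : 0 < lam) (halpha : 0 < alpha)
    (homega : omegaN ∈ Set.Ioo (0 : ℝ) 1)
    (f : ℝ → ℝ) (hf : Differentiable ℝ f) (hf0 : f 0 = 0)
    (hf' : ∀ x : ℝ, 0 ≤ deriv f x ∧ deriv f x ≤ alpha)
    (u : ℝ) (hu : 0 < u)
    (hstar hplus hminus : ℝ)
    (hdecomp : r * f u = (1 - omegaN) * hstar + omegaN * hplus)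
    (unew : ℝ) (hnew : r * unew = r * u - lam * (hplus - hminus))
    (hs : 0 ≤ hstar) (hp : 0 ≤ hplus) (hm : 0 ≤ hminus)
    (hCFL : alpha * lam ≤ omegaN) :
    0 ≤ unew ∧ (alpha * lam < omegaN → 0 < unew) := by
  obtain ⟨ho0, ho1⟩ := homega
  have h1 : f u ≤ alpha * u := by
    have h := image_sub_le_mul_sub_of_deriv_le hf (fun x => (hf' x).2) hu.le
    simpa [hf0] using h
  have h2 : omegaN * hplus ≤ r * (alpha * u) := by
    have h3 := mul_le_mul_of_nonneg_left h1 hr.le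
    have h4 : 0 ≤ (1 - omegaN) * hstar := mul_nonneg (by linarith) hs
    linarith
  have h5 := mul_le_mul_of_nonneg_left h2 hlam.le
  have h6 : 0 ≤ lam * (omegaN * hminus) := by positivity
  have key : (r * u) * (omegaN - alpha * lam) ≤ (omegaN * r) * unew := by
    have h7 : (omegaN * r) * unew = omegaN * (r * u - lam * (hplus - hminus)) := by
      rw [← hnew]; ring
    rw [h7]
    linarith
  have hpos : 0 < omegaN * r := by positivity
  have hru : 0 < r * u := by positivity
  constructor
  · have h8 : 0 ≤ (r * u) * (omegaN - alpha * lam) := mul_nonneg hru.le (by linarith)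
    exact (mul_nonneg_iff_of_pos_left hpos).1 (h8.trans key)
  · intro hlt
    have h8 : 0 < (r * u) * (omegaN - alpha * lam) := mul_pos hru (by linarith)
    exact (mul_pos_iff_of_pos_left hpos).1 (h8.trans_le key)
end

section
/- (Theorem 2.2, positivity of the forward-Euler finite-difference scheme for a monotone decreasing flux in cylindrical coordinates.) Let r_i > 0, λ > 0, α > 0 and ω_1 ∈ (0,1) be real numbers, let f : ℝ → ℝ be differentiable with f(0) = 0 and −α ≤ f'(x) ≤ 0 for all x ∈ ℝ, and let u_i > 0 be a real number. Suppose the real numbers h_star, h_plus, h_minus satisfy the Gauss–Lobatto decomposition r_i·f(u_i) = (1 − ω_1)·h_star + ω_1·h_minus. Define u_new by r_i·u_new = r_i·u_i − λ·(h_plus − h_minus). If h_star ≤ 0, h_plus ≤ 0, h_minus ≤ 0 and α·λ ≤ ω_1, then u_new ≥ 0; if moreover the strict CFL condition α·λ < ω_1 holds, then u_new > 0. -/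
/-- Theorem 2.2: positivity of the forward-Euler finite-difference scheme for a
monotone decreasing flux in cylindrical coordinates. -/
theorem stmt_1
    (r lam alpha omega1 : ℝ) (hr : 0 < r) (hlam : 0 < lam) (halpha : 0 < alpha)
    (homega : omega1 ∈ Set.Ioo (0 : ℝ) 1)
    (f : ℝ → ℝ) (hf : Differentiable ℝ f) (hf0 : f 0 = 0)
    (hf' : ∀ x : ℝ, -alpha ≤ deriv f x ∧ deriv f x ≤ 0)
    (u : ℝ) (hu : 0 < u)
    (hstar hplus hminus : ℝ)
    (hdecomp : r * f u = (1 - omega1) * hstar + omega1 * hminus)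
    (unew : ℝ) (hnew : r * unew = r * u - lam * (hplus - hminus))
    (hs : hstar ≤ 0) (hp : hplus ≤ 0) (hm : hminus ≤ 0)
    (hCFL : alpha * lam ≤ omega1) :
    0 ≤ unew ∧ (alpha * lam < omega1 → 0 < unew) := by
  obtain ⟨h0, h1⟩ := homega
  have hfu : -alpha * u ≤ f u := by
    obtain ⟨c, _, hc⟩ := exists_deriv_eq_slope f hu hf.continuous.continuousOn
      hf.differentiableOn
    have h := (hf' c).1
    rw [hc, hf0, sub_zero, sub_zero, le_div_iff₀ hu] at h
    exact h
  have hA : r * (-alpha * u) ≤ r * f u := mul_le_mul_of_nonneg_left hfu hr.le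
  have hB : (1 - omega1) * hstar ≤ 0 := mul_nonpos_of_nonneg_of_nonpos (by linarith) hs
  have hC : r * (-alpha * u) ≤ omega1 * hminus := by linarith
  have hD : lam * (r * (-alpha * u)) ≤ lam * (omega1 * hminus) :=
    mul_le_mul_of_nonneg_left hC hlam.le
  have hE : omega1 * lam * hplus ≤ 0 :=
    mul_nonpos_of_nonneg_of_nonpos (by positivity) hp
  have key : r * u * (omega1 - alpha * lam) ≤ omega1 * r * unew := by
    have : omega1 * r * unew = omega1 * (r * u - lam * (hplus - hminus)) := by
      rw [← hnew]; ring
    rw [this]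
    linarith
  have hru : 0 < r * u := mul_pos hr hu
  have hor : 0 < omega1 * r := mul_pos h0 hr
  constructor
  · have h := mul_nonneg hru.le (sub_nonneg.2 hCFL)
    exact nonneg_of_mul_nonneg_right (h.trans key) hor
  · intro hlt
    have h := mul_pos hru (sub_pos.2 hlt)
    exact pos_of_mul_pos_right (h.trans_le key) hor.le
end

section
/- (Theorem 2.3, positivity of the flux-split forward-Euler finite-difference scheme in cylindrical coordinates, general flux.) Let r_i > 0, λ > 0, α₊ > 0, α₋ > 0 and ω ∈ (0,1) be real numbers, let f : ℝ → ℝ be differentiable with f(0) = 0, |f'(x)| ≤ α₊ and |f'(x)| ≤ α₋ for all x ∈ ℝ, and let u_i > 0. Define the split cell averages q̄p₊ = (1/2)·r_i·(u_i + f(u_i)/α₊), q̄m₊ = (1/2)·r_i·(u_i − f(u_i)/α₊), q̄p₋ = (1/2)·r_i·(u_i + f(u_i)/α₋), q̄m₋ = (1/2)·r_i·(u_i − f(u_i)/α₋). Suppose the real numbers a, b, c, d, h1_star, h2_star satisfy the Gauss–Lobatto decompositions q̄p₊ = (1 − ω)·h1_star + ω·a and q̄m₋ = (1 − ω)·h2_star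 + ω·d. Define u_new by r_i·u_new = r_i·u_i − λ·( α₊·(a − b) − α₋·(c − d) ). If c ≥ 0, h1_star ≥ 0, a ≥ 0, d ≥ 0, h2_star ≥ 0, b ≥ 0 and λ·max(α₊, α₋) ≤ ω/2, then u_new > 0. -/
/-- Theorem 2.3: positivity of the flux-split forward-Euler finite-difference
scheme in cylindrical coordinates, for a general flux. -/
theorem stmt_2
    (r lam alphaP alphaM omega : ℝ)
    (hr : 0 < r) (hlam : 0 < lam) (halphaP : 0 < alphaP) (halphaM : 0 < alphaM)
    (homega : omega ∈ Set.Ioo (0 : ℝ) 1)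
    (f : ℝ → ℝ) (hf : Differentiable ℝ f) (hf0 : f 0 = 0)
    (hfP : ∀ x : ℝ, |deriv f x| ≤ alphaP) (hfM : ∀ x : ℝ, |deriv f x| ≤ alphaM)
    (u : ℝ) (hu : 0 < u)
    (a b c d h1star h2star : ℝ)
    (hdecomp1 : (1 / 2) * r * (u + f u / alphaP) = (1 - omega) * h1star + omega * a)
    (hdecomp2 : (1 / 2) * r * (u - f u / alphaM) = (1 - omega) * h2star + omega * d)
    (unew : ℝ)
    (hnew : r * unew = r * u - lam * (alphaP * (a - b) - alphaM * (c - d)))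
    (hc : 0 ≤ c) (h1 : 0 ≤ h1star) (ha : 0 ≤ a)
    (hd : 0 ≤ d) (h2 : 0 ≤ h2star) (hb : 0 ≤ b)
    (hCFL : lam * max alphaP alphaM ≤ omega / 2) :
    0 < unew := by
  obtain ⟨ho0, ho1⟩ := homega
  have key : ∀ C : ℝ, (∀ x : ℝ, |deriv f x| ≤ C) → |f u| ≤ C * u := by
    intro C hC
    have h := Convex.norm_image_sub_le_of_norm_deriv_le (f := f) (C := C) (s := Set.univ)
      (x := 0) (y := u) (fun x _ => hf x) (fun x _ => by simpa using hC x) convex_univ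
      (Set.mem_univ _) (Set.mem_univ _)
    simpa [hf0, Real.norm_eq_abs, abs_of_pos hu] using h
  have kP := abs_le.mp (key alphaP hfP)
  have kM := abs_le.mp (key alphaM hfM)
  have hP : lam * alphaP ≤ omega / 2 :=
    (mul_le_mul_of_nonneg_left (le_max_left _ _) hlam.le).trans hCFL
  have hM : lam * alphaM ≤ omega / 2 :=
    (mul_le_mul_of_nonneg_left (le_max_right _ _) hlam.le).trans hCFL
  have e1 : lam * alphaP * a ≤ omega / 2 * a := mul_le_mul_of_nonneg_right hP ha
  have e2 : lam * alphaM * d ≤ omega / 2 * d := mul_le_mul_of_nonneg_right hM hd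
  have e3 : 0 ≤ (1 - omega) * h1star := mul_nonneg (by linarith) h1
  have e4 : 0 ≤ (1 - omega) * h2star := mul_nonneg (by linarith) h2
  have e5 : 0 ≤ lam * alphaP * b := by positivity
  have e6 : 0 ≤ lam * alphaM * c := by positivity
  have g : f u / alphaP - f u / alphaM ≤ u := by
    have g1 : f u / alphaP ≤ u := by rw [div_le_iff₀ halphaP]; linarith
    have g2 : -u ≤ f u / alphaM := by rw [le_div_iff₀ halphaM]; linarith
    rcases le_total 0 (f u) with h | h
    · have := div_nonneg h halphaM.le
      linarith
    · have := div_nonpos_of_nonpos_of_nonneg h halphaP.le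
      linarith
  have g' := mul_le_mul_of_nonneg_left g hr.le
  have hru : 0 < r * u := mul_pos hr hu
  have : 0 < r * unew := by rw [hnew]; linarith
  exact pos_of_mul_pos_right this hr.le
end

section
/- (Simplified sufficient condition when the flux is monotone increasing over the right stencil and split only over the left stencil.) Let r_i > 0, λ > 0, α₊ > 0, α₋ > 0 and ω ∈ (0,1) be real numbers, let f : ℝ → ℝ be differentiable with f(0) = 0, 0 ≤ f'(x) ≤ α₊ and |f'(x)| ≤ α₋ for all x ∈ ℝ, and let u_i > 0. Suppose the real numbers h_plus, h_star, c, d, h2_star satisfy r_i·f(u_i) = (1 − ω)·h_star + ω·h_plus and (1/2)·r_i·(u_i − f(u_i)/α₋) = (1 − ω)·h2_star + ω·d. Define u_new by r_i·u_new = r_i·u_i − λ·( h_plus − α₋·(c − d) ). If h_plus ≥ 0, h_star ≥ 0, d ≥ 0, h2_star ≥ 0, c ≥ 0 and λ·max(α₊, α₋) ≤ ω/2, then u_new > 0. -/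
/-- Simplified sufficient condition when the flux is monotone increasing over the
right stencil and split only over the left stencil. -/
theorem stmt_3
    (r lam alphaP alphaM omega : ℝ)
    (hr : 0 < r) (hlam : 0 < lam) (halphaP : 0 < alphaP) (halphaM : 0 < alphaM)
    (homega : omega ∈ Set.Ioo (0 : ℝ) 1)
    (f : ℝ → ℝ) (hf : Differentiable ℝ f) (hf0 : f 0 = 0)
    (hfP : ∀ x : ℝ, 0 ≤ deriv f x ∧ deriv f x ≤ alphaP)
    (hfM : ∀ x : ℝ, |deriv f x| ≤ alphaM)
    (u : ℝ) (hu : 0 < u)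
    (hplus hstar c d h2star : ℝ)
    (hdecomp1 : r * f u = (1 - omega) * hstar + omega * hplus)
    (hdecomp2 : (1 / 2) * r * (u - f u / alphaM) = (1 - omega) * h2star + omega * d)
    (unew : ℝ)
    (hnew : r * unew = r * u - lam * (hplus - alphaM * (c - d)))
    (hp : 0 ≤ hplus) (hs : 0 ≤ hstar) (hd : 0 ≤ d) (h2 : 0 ≤ h2star) (hc : 0 ≤ c)
    (hCFL : lam * max alphaP alphaM ≤ omega / 2) :
    0 < unew := by
  obtain ⟨ho0, ho1⟩ := homega
  have hM : lam * alphaM ≤ omega / 2 :=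
    le_trans (mul_le_mul_of_nonneg_left (le_max_right _ _) hlam.le) hCFL
  obtain ⟨g, hg⟩ : ∃ g, g = f u / alphaM := ⟨_, rfl⟩
  have hfg : f u = alphaM * g := by rw [hg]; field_simp
  rw [← hg] at hdecomp2
  rw [hfg] at hdecomp1
  have e1 : 0 ≤ (1 - omega) * hstar := mul_nonneg (by linarith) hs
  have e2 : 0 ≤ (1 - omega) * h2star := mul_nonneg (by linarith) h2
  have e3 : 0 ≤ omega * d := mul_nonneg ho0.le hd
  have e4 : lam * alphaM * hplus ≤ omega / 2 * hplus := mul_le_mul_of_nonneg_right hM hp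
  have e5 : lam * alphaM * d ≤ omega / 2 * d := mul_le_mul_of_nonneg_right hM hd
  have e6 : 0 ≤ lam * alphaM * c := by positivity
  have e7 : lam * hplus ≤ r * g / 2 := by
    have : alphaM * (lam * hplus) ≤ alphaM * (r * g / 2) := by linarith
    exact le_of_mul_le_mul_left this halphaM
  have e8 : 0 < r * u := mul_pos hr hu
  have e9 : 0 < r * unew := by linarith
  exact pos_of_mul_pos_right e9 hr.le
end

section
/- (Linear scaling positivity-preserving limiter.) Let m, h̄, q be real numbers with m ≤ h̄ and q < h̄, and set θ = min( (h̄ − m)/(h̄ − q), 1 ). Then 0 ≤ θ ≤ 1; for every real number v with v ≥ q, the limited value θ·(v − h̄) + h̄ satisfies θ·(v − h̄) + h̄ ≥ m; and for every real a < b and every function h : ℝ → ℝ that is interval-integrable on [a,b] with average (1/(b−a))·∫_a^b h(x) dx = h̄, the limited function ĥ(x) = θ·(h(x) − h̄) + h̄ also has average (1/(b−a))·∫_a^b ĥ(x) dx = h̄. -/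
open MeasureTheory intervalIntegral

/-- Linear scaling positivity-preserving limiter: it is a convex scaling, it
enforces the lower bound `m` at all sample values `≥ q`, and it preserves the
cell average. -/
theorem stmt_4
    (m hbar q : ℝ) (hm : m ≤ hbar) (hq : q < hbar)
    (θ : ℝ) (hθ : θ = min ((hbar - m) / (hbar - q)) 1) :
    (0 ≤ θ ∧ θ ≤ 1) ∧
    (∀ v : ℝ, q ≤ v → m ≤ θ * (v - hbar) + hbar) ∧
    (∀ (a b : ℝ) (h : ℝ → ℝ), a < b →
      IntervalIntegrable h MeasureTheory.volume a b →
      (1 / (b - a)) * (∫ x in a..b, h x) = hbar →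
      (1 / (b - a)) * (∫ x in a..b, (θ * (h x - hbar) + hbar)) = hbar) := by
  have hd : 0 < hbar - q := by linarith
  have h0 : 0 ≤ θ := by
    rw [hθ]
    exact le_min (div_nonneg (by linarith) hd.le) zero_le_one
  have h1 : θ ≤ 1 := by
    rw [hθ]
    exact min_le_right _ _
  have h2 : θ * (hbar - q) ≤ hbar - m := by
    rw [← le_div_iff₀ hd, hθ]
    exact min_le_left _ _
  refine ⟨⟨h0, h1⟩, ?_, ?_⟩
  · intro v hv
    nlinarith [mul_nonneg h0 (sub_nonneg.2 hv)]
  · intro a b h hab hi hav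
    have hba : b - a ≠ 0 := by
      have : 0 < b - a := by linarith
      exact this.ne'
    have hc : ∀ c : ℝ, IntervalIntegrable (fun _ => c) MeasureTheory.volume a b :=
      fun c => intervalIntegrable_const
    have hI : (∫ x in a..b, h x) = hbar * (b - a) := by
      rw [← hav]
      field_simp
    rw [intervalIntegral.integral_add ((hi.sub (hc hbar)).const_mul θ) (hc hbar),
      intervalIntegral.integral_const_mul, intervalIntegral.integral_sub hi (hc hbar), hI,
      intervalIntegral.integral_const, smul_eq_mul]
    field_simp
    ring
end

section
/- (Sufficient condition for positivity with convection, diffusion and source terms.) Let Δr > 0, Δt > 0 and set λ = Δt/Δr. Let r_i > 0, r_plus ≥ 0, r_minus ≥ 0 be reals with r_plus + r_minus = 2·r_i, let D ≥ 0, let u_i > 0, u_ip1 ≥ 0, u_im1 ≥ 0 be reals, and let G and S be reals. Define u_new by r_i·u_new = r_i·u_i − λ·G + r_i·S·Δt + λ·D·( r_plus·(u_ip1 − u_i)/Δr − r_minus·(u_i − u_im1)/Δr ). If r_i·u_i − 4·λ·G > 0, u_i + 2·S·Δt ≥ 0, and 8·D·λ ≤ Δr, then u_new > 0. -/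
/-- Sufficient condition for positivity of the forward-Euler update with
convection, diffusion and source terms. -/
theorem stmt_13
    (dr dt : ℝ) (hdr : 0 < dr) (hdt : 0 < dt)
    (lam : ℝ) (hlam : lam = dt / dr)
    (ri rplus rminus : ℝ) (hri : 0 < ri) (hrp : 0 ≤ rplus) (hrm : 0 ≤ rminus)
    (hsum : rplus + rminus = 2 * ri)
    (D : ℝ) (hD : 0 ≤ D)
    (ui uip1 uim1 : ℝ) (hui : 0 < ui) (huip1 : 0 ≤ uip1) (huim1 : 0 ≤ uim1)
    (G S : ℝ)
    (unew : ℝ)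
    (hnew : ri * unew = ri * ui - lam * G + ri * S * dt +
      lam * D * (rplus * (uip1 - ui) / dr - rminus * (ui - uim1) / dr))
    (hconv : 0 < ri * ui - 4 * lam * G)
    (hsrc : 0 ≤ ui + 2 * S * dt)
    (hdiff : 8 * D * lam ≤ dr) :
    0 < unew := by
  have hl : 0 ≤ lam := by rw [hlam]; positivity
  obtain ⟨k, hk⟩ : ∃ k, k = lam * D / dr := ⟨_, rfl⟩
  have hk0 : 0 ≤ k := by rw [hk]; positivity
  have hk8 : k ≤ 1 / 8 := by
    rw [hk, div_le_iff₀ hdr]; linarith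
  have e : lam * D * (rplus * (uip1 - ui) / dr - rminus * (ui - uim1) / dr)
      = k * (rplus * uip1) + k * (rminus * uim1) - k * ((rplus + rminus) * ui) := by
    rw [hk]; ring
  rw [e, hsum] at hnew
  have h1 : 0 ≤ k * (rplus * uip1) := by positivity
  have h2 : 0 ≤ k * (rminus * uim1) := by positivity
  have h3 : k * (2 * ri * ui) ≤ 1 / 8 * (2 * ri * ui) :=
    mul_le_mul_of_nonneg_right hk8 (by positivity)
  have h4 : 0 ≤ ri * (ui + 2 * S * dt) := mul_nonneg hri.le hsrc
  have h5 : 0 < ri * unew := by rw [hnew]; linarith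
  exact (mul_pos_iff_of_pos_left hri).mp h5
end
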